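/- arXiv:1708.07068 — 4 statements merged into one kernel-verified Lean document; each statement's English description precedes it below -/
import Mathlib

section
/- Let (g, V, Θ) be a Lie-Leibniz triple, let h = Θ(V) be the image of Θ (a Lie subalgebra of g by the quadratic constraint), let Z be the center of (V, •), and let h_V = V ⧸ Z be the gauge algebra of V, i.e. the quotient vector space equipped with the Lie bracket induced by •, with quotient map π : V → V ⧸ Z. Then Ker Θ ⊆ Z, and there exists a unique surjective Lie algebra morphism φ : h → h_V such that φ(Θ(x)) = π(x) for every x ∈ V. Moreover, φ is an isomorphism if and only if V is a faithful h-module. -/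
/-- `IsGaugeMorphism Θ Z B φ` says that `φ` is a surjective Lie algebra morphism
from `h = Im Θ` (with the bracket inherited from `g`) to `h_V = V ⧸ Z`
(with the induced bracket `B`) satisfying `φ (Θ x) = π x` for all `x ∈ V`. -/
def IsGaugeMorphism {g V : Type*} [LieRing g] [LieAlgebra ℝ g]
    [AddCommGroup V] [Module ℝ V]
    (Θ : V →ₗ[ℝ] g) (Z : Submodule ℝ V)
    (B : (V ⧸ Z) →ₗ[ℝ] (V ⧸ Z) →ₗ[ℝ] (V ⧸ Z))
    (φ : ↥(LinearMap.range Θ) →ₗ[ℝ] V ⧸ Z) : Prop :=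
  Function.Surjective φ ∧
  (∀ x : V, φ ⟨Θ x, LinearMap.mem_range_self Θ x⟩ = Submodule.Quotient.mk x) ∧
  (∀ u v : ↥(LinearMap.range Θ), ∀ huv : ⁅(u : g), (v : g)⁆ ∈ LinearMap.range Θ,
    φ ⟨⁅(u : g), (v : g)⁆, huv⟩ = B (φ u) (φ v))

/-- Given a Lie-Leibniz triple `(g, V, Θ)`, with `Z` the center of the Leibniz
algebra `(V, •)` and `B` the Lie bracket on `h_V = V ⧸ Z` induced by `•`,
one has `Ker Θ ⊆ Z`, there is a unique surjective Lie algebra morphism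
`φ : Im Θ → V ⧸ Z` with `φ ∘ Θ = π`, and `φ` is an isomorphism iff `V` is a
faithful `Im Θ`-module. -/
theorem lieLeibniz_gauge_morphism {g V : Type*} [LieRing g] [LieAlgebra ℝ g]
    [AddCommGroup V] [Module ℝ V]
    (mul : V →ₗ[ℝ] V →ₗ[ℝ] V)
    (hLeib : ∀ x y z : V, mul x (mul y z) = mul (mul x y) z + mul y (mul x z))
    (ρ : g →ₗ[ℝ] Module.End ℝ V)
    (hρ : ∀ a b : g, ρ ⁅a, b⁆ = ρ a ∘ₗ ρ b - ρ b ∘ₗ ρ a)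
    (Θ : V →ₗ[ℝ] g)
    (hlin : ∀ x y : V, mul x y = ρ (Θ x) y)
    (hquad : ∀ x y : V, Θ (mul x y) = ⁅Θ x, Θ y⁆)
    (Z : Submodule ℝ V) (hZ : ∀ x : V, x ∈ Z ↔ ∀ y : V, mul x y = 0)
    (B : (V ⧸ Z) →ₗ[ℝ] (V ⧸ Z) →ₗ[ℝ] (V ⧸ Z))
    (hB : ∀ x y : V, B (Submodule.Quotient.mk x) (Submodule.Quotient.mk y) =
      Submodule.Quotient.mk (mul x y)) :
    LinearMap.ker Θ ≤ Z ∧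
    (∃! φ : ↥(LinearMap.range Θ) →ₗ[ℝ] V ⧸ Z, IsGaugeMorphism Θ Z B φ) ∧
    (∀ φ : ↥(LinearMap.range Θ) →ₗ[ℝ] V ⧸ Z, IsGaugeMorphism Θ Z B φ →
      (Function.Bijective φ ↔
        ∀ a : g, a ∈ LinearMap.range Θ → (∀ x : V, ρ a x = 0) → a = 0)) := by
  have hker : LinearMap.ker Θ ≤ Z := fun x hx => (hZ x).2 fun y => by
    rw [hlin, LinearMap.mem_ker.1 hx, map_zero, LinearMap.zero_apply]
  refine ⟨hker, ?_, ?_⟩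
  · let φ : ↥(LinearMap.range Θ) →ₗ[ℝ] V ⧸ Z :=
      (LinearMap.ker Θ).liftQ Z.mkQ (by rwa [Submodule.ker_mkQ]) ∘ₗ
        Θ.quotKerEquivRange.symm.toLinearMap
    have hφ : ∀ x : V, φ ⟨Θ x, LinearMap.mem_range_self Θ x⟩ = Submodule.Quotient.mk x := by
      intro x
      simp only [φ, LinearMap.comp_apply, LinearEquiv.coe_coe]
      rw [LinearMap.quotKerEquivRange_symm_apply_image Θ x (LinearMap.mem_range_self Θ x)]
      rfl
    refine ⟨φ, ⟨?_, hφ, ?_⟩, ?_⟩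
    · intro q
      obtain ⟨x, rfl⟩ := Submodule.Quotient.mk_surjective Z q
      exact ⟨_, hφ x⟩
    · rintro ⟨_, x, rfl⟩ ⟨_, y, rfl⟩ huv
      rw [hφ, hφ, hB, ← hφ]
      congr 1
      exact Subtype.ext (hquad x y).symm
    · rintro ψ ⟨-, hψ, -⟩
      ext ⟨_, x, rfl⟩
      rw [hψ, hφ]
  · rintro φ ⟨hsurj, hφ, -⟩
    constructor
    · rintro ⟨hinj, -⟩ _ ⟨x, rfl⟩ hx
      have hxZ : x ∈ Z := (hZ x).2 fun y => by rw [hlin, hx]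
      have h : φ ⟨Θ x, LinearMap.mem_range_self Θ x⟩ = φ 0 := by
        rw [hφ, map_zero, Submodule.Quotient.mk_eq_zero]
        exact hxZ
      exact congrArg Subtype.val (hinj h)
    · intro hfaith
      refine ⟨(injective_iff_map_eq_zero φ).2 ?_, hsurj⟩
      rintro ⟨_, x, rfl⟩ hx
      rw [hφ, Submodule.Quotient.mk_eq_zero, hZ] at hx
      exact Subtype.ext (hfaith _ (LinearMap.mem_range_self Θ x) fun y => by rw [← hlin, hx])
end

section
/- Let (V, •) be a Leibniz algebra and let Z be its center. Then Z is a linear subspace of V, and there exists a Lie algebra structure on the quotient vector space V ⧸ Z (a bilinear, skew-symmetric bracket satisfying the Jacobi identity) such that the quotient map π : V → V ⧸ Z satisfies π(x • y) = ⁅π(x), π(y)⁆ for all x, y ∈ V. -/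
/-- For a Leibniz algebra `(V, •)`, the center `Z = {x | x • y = 0 ∀ y}` is a
linear subspace of `V`, and the quotient `V ⧸ Z` carries a Lie algebra
structure (a bilinear skew-symmetric bracket satisfying the Jacobi identity)
such that the quotient map `π` satisfies `π (x • y) = ⁅π x, π y⁆`. -/
theorem leibniz_quotient_center_lie {V : Type*} [AddCommGroup V] [Module ℝ V]
    (mul : V →ₗ[ℝ] V →ₗ[ℝ] V)
    (hLeib : ∀ x y z : V, mul x (mul y z) = mul (mul x y) z + mul y (mul x z)) :
    ∃ Z : Submodule ℝ V, (∀ x : V, x ∈ Z ↔ ∀ y : V, mul x y = 0) ∧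
      ∃ B : (V ⧸ Z) →ₗ[ℝ] (V ⧸ Z) →ₗ[ℝ] (V ⧸ Z),
        (∀ u v : V ⧸ Z, B u v = - B v u) ∧
        (∀ u v w : V ⧸ Z, B (B u v) w + B (B v w) u + B (B w u) v = 0) ∧
        (∀ x y : V, B (Submodule.Quotient.mk x) (Submodule.Quotient.mk y) =
          Submodule.Quotient.mk (mul x y)) := by
  have mul_mul_apply (x y z : V) : mul (mul x y) z = mul x (mul y z) - mul y (mul x z) :=
    eq_sub_of_add_eq (hLeib x y z).symm
  have hZ (x : V) : x ∈ LinearMap.ker mul ↔ ∀ y : V, mul x y = 0 := by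
    simp [LinearMap.ext_iff]
  have hleft : LinearMap.ker mul ≤ LinearMap.ker (mul.compr₂ (LinearMap.ker mul).mkQ) := by
    intro x hx
    ext y
    simp [(hZ x).1 hx y]
  let C := (LinearMap.ker mul).liftQ (mul.compr₂ (LinearMap.ker mul).mkQ) hleft
  have hright : LinearMap.ker mul ≤ LinearMap.ker C.flip := by
    intro z hz
    refine LinearMap.ext fun u => ?_
    obtain ⟨x, rfl⟩ := Submodule.Quotient.mk_surjective _ u
    refine (Submodule.Quotient.mk_eq_zero _).2 ((hZ _).2 fun w => ?_)
    rw [mul_mul_apply, (hZ z).1 hz, (hZ z).1 hz, map_zero, sub_zero]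
  let B := ((LinearMap.ker mul).liftQ C.flip hright).flip
  have hB (x y : V) : B (Submodule.Quotient.mk x) (Submodule.Quotient.mk y) =
      Submodule.Quotient.mk (mul x y) := rfl
  refine ⟨LinearMap.ker mul, hZ, B, fun u v => ?_, fun u v w => ?_, hB⟩
  · obtain ⟨x, rfl⟩ := Submodule.Quotient.mk_surjective _ u
    obtain ⟨y, rfl⟩ := Submodule.Quotient.mk_surjective _ v
    rw [hB, hB, ← Submodule.Quotient.mk_neg, Submodule.Quotient.eq, hZ]
    intro z
    simp only [map_sub, map_neg, LinearMap.sub_apply, LinearMap.neg_apply, mul_mul_apply]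
    abel
  · obtain ⟨x, rfl⟩ := Submodule.Quotient.mk_surjective _ u
    obtain ⟨y, rfl⟩ := Submodule.Quotient.mk_surjective _ v
    obtain ⟨z, rfl⟩ := Submodule.Quotient.mk_surjective _ w
    simp only [hB, ← Submodule.Quotient.mk_add]
    rw [Submodule.Quotient.mk_eq_zero, hZ]
    intro t
    simp only [map_add, LinearMap.add_apply, mul_mul_apply _ _ t]
    simp only [map_sub, mul_mul_apply]
    abel
end

section
/- Let (V, •) be a Leibniz algebra. Then for all x, y, z ∈ V, the Jacobiator of the skew-symmetric bracket satisfies [x, [y, z]] + [y, [z, x]] + [z, [x, y]] = −(1/3)({x, [y, z]} + {y, [z, x]} + {z, [x, y]}). -/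
/-- The skew-symmetric bracket `[x, y] = (1/2)(x • y − y • x)` of a Leibniz
algebra. -/
noncomputable def skewBr {V : Type*} [AddCommGroup V] [Module ℝ V]
    (mul : V →ₗ[ℝ] V →ₗ[ℝ] V) (x y : V) : V :=
  (1 / 2 : ℝ) • (mul x y - mul y x)

/-- The symmetric bracket `{x, y} = (1/2)(x • y + y • x)` of a Leibniz
algebra. -/
noncomputable def symBr {V : Type*} [AddCommGroup V] [Module ℝ V]
    (mul : V →ₗ[ℝ] V →ₗ[ℝ] V) (x y : V) : V :=
  (1 / 2 : ℝ) • (mul x y + mul y x)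

/-- In a Leibniz algebra, the Jacobiator of the skew-symmetric bracket is
`[x,[y,z]] + [y,[z,x]] + [z,[x,y]] = −(1/3)({x,[y,z]} + {y,[z,x]} + {z,[x,y]})`. -/
theorem leibniz_jacobiator {V : Type*} [AddCommGroup V] [Module ℝ V]
    (mul : V →ₗ[ℝ] V →ₗ[ℝ] V)
    (hLeib : ∀ x y z : V, mul x (mul y z) = mul (mul x y) z + mul y (mul x z))
    (x y z : V) :
    skewBr mul x (skewBr mul y z) + skewBr mul y (skewBr mul z x) +
        skewBr mul z (skewBr mul x y) =
      -(1 / 3 : ℝ) • (symBr mul x (skewBr mul y z) + symBr mul y (skewBr mul z x) +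
        symBr mul z (skewBr mul x y)) := by
  have hassoc (a b c : V) : mul (mul a b) c = mul a (mul b c) - mul b (mul a c) :=
    eq_sub_of_add_eq (hLeib a b c).symm
  simp only [skewBr, symBr, map_smul, map_sub, LinearMap.smul_apply, LinearMap.sub_apply, hassoc]
  module
end

section
/- Let A be an associative real algebra (not necessarily commutative) and let P : A → A be a linear map such that P(P(x)·y) = P(x)·P(y) = P(x·P(y)) for all x, y ∈ A. Then the bilinear product defined by x • y = P(x)·y − y·P(x) satisfies the Leibniz identity x • (y • z) = (x • y) • z + y • (x • z) for all x, y, z ∈ A; hence (A, •) is a Leibniz algebra. -/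
/-- The product `x • y = P x * y − y * P x` on an associative algebra `A`
built from an averaging-type operator `P`. -/
def leibOf {A : Type*} [NonUnitalRing A] [Module ℝ A]
    (P : A →ₗ[ℝ] A) (x y : A) : A :=
  P x * y - y * P x

/-- Let `A` be an associative real algebra and `P : A → A` a linear map with
`P (P x * y) = P x * P y = P (x * P y)`. Then `x • y = P x * y − y * P x`
satisfies the Leibniz identity, so `(A, •)` is a Leibniz algebra. -/
theorem rotaBaxter_type_leibniz {A : Type*} [NonUnitalRing A] [Module ℝ A]
    [SMulCommClass ℝ A A] [IsScalarTower ℝ A A]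
    (P : A →ₗ[ℝ] A)
    (hP1 : ∀ x y : A, P (P x * y) = P x * P y)
    (hP2 : ∀ x y : A, P (x * P y) = P x * P y) :
    ∀ x y z : A,
      leibOf P x (leibOf P y z) =
        leibOf P (leibOf P x y) z + leibOf P y (leibOf P x z) := by
  intro x y z
  simp only [leibOf, map_sub, hP1, hP2]
  noncomm_ring
end
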